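/- Let D be a nonempty weakly compact convex subset of a Banach space X that is uniformly convex in every direction (UCED), let t : D → D be a single-valued mapping and T : D → KC(D) a multivalued mapping, both satisfying conditions (E) and (C_λ) for some λ ∈ (0,1), and suppose t and T commute. Then there exists a point z ∈ D such that z = t(z) ∈ T(z). -/

import Mathlib

/-- A Banach space is uniformly convex in every direction (UCED): for every
`ε ∈ (0,2]` and every unit vector `z` there is `δ > 0` such that whenever
`‖x‖ ≤ 1`, `‖y‖ ≤ 1` and `x - y = s • z` with `s ∈ [-2,-ε] ∪ [ε,2]`, one has
`‖x + y‖ ≤ 2(1 - δ)`. -/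
def UCED (X : Type*) [NormedAddCommGroup X] [NormedSpace ℝ X] : Prop :=
  ∀ ε ∈ Set.Ioc (0:ℝ) 2, ∀ z : X, ‖z‖ = 1 → ∃ δ > (0:ℝ), ∀ x y : X,
    ‖x‖ ≤ 1 → ‖y‖ ≤ 1 →
    (∃ s ∈ Set.Icc (-2:ℝ) (-ε) ∪ Set.Icc ε 2, x - y = s • z) →
    ‖x + y‖ ≤ 2 * (1 - δ)

open Filter Topology Set

section WeakTopology

variable {X : Type*} [NormedAddCommGroup X] [NormedSpace ℝ X]

/-- A continuous convex function is weakly lower semicontinuous. -/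
lemma ConvexOn.lowerSemicontinuous_weakSpace {f : X → ℝ} (hf : ConvexOn ℝ univ f)
    (hc : Continuous f) :
    LowerSemicontinuous fun w : WeakSpace ℝ X => f ((toWeakSpace ℝ X).symm w) := by
  rw [lowerSemicontinuous_iff_isClosed_preimage]
  intro c
  have hconv : Convex ℝ {v | f v ≤ c} := by simpa using hf.convex_le c
  have hclosed : IsClosed {v | f v ≤ c} := isClosed_le hc continuous_const
  have h := hconv.toWeakSpace_closure (𝕜 := ℝ)
  rw [hclosed.closure_eq] at h
  have heq : (fun w : WeakSpace ℝ X => f ((toWeakSpace ℝ X).symm w)) ⁻¹' Iic c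
      = toWeakSpace ℝ X '' {v | f v ≤ c} := by
    rw [LinearEquiv.image_eq_preimage_symm]
    rfl
  rw [heq, h]
  exact isClosed_closure

/-- A continuous convex function attains its minimum on a weakly compact set. -/
lemma ConvexOn.exists_isMinOn_of_isCompact_weakSpace {f : X → ℝ} (hf : ConvexOn ℝ univ f)
    (hc : Continuous f) {D : Set X} (hne : D.Nonempty)
    (hD : IsCompact (toWeakSpace ℝ X '' D)) : ∃ z ∈ D, IsMinOn f D z := by
  obtain ⟨w, ⟨z, hz, rfl⟩, hmin⟩ :=
    (hf.lowerSemicontinuous_weakSpace hc).lowerSemicontinuousOn _ |>.exists_isMinOn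
      (hne.image _) hD
  refine ⟨z, hz, fun v hv => ?_⟩
  simpa using hmin (mem_image_of_mem _ hv)

/-- Weakly compact sets are norm bounded. -/
lemma exists_norm_le_of_isCompact_weakSpace {D : Set X}
    (hD : IsCompact (toWeakSpace ℝ X '' D)) : ∃ C, ∀ x ∈ D, ‖x‖ ≤ C := by
  have hb : ∀ f : StrongDual ℝ X, ∃ C, ∀ x : D,
      ‖NormedSpace.inclusionInDoubleDualLi (E := X) ℝ x.1 f‖ ≤ C := by
    intro f
    have hcont : Continuous fun w : WeakSpace ℝ X => f ((toWeakSpace ℝ X).symm w) :=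
      WeakBilin.eval_continuous _ f
    obtain ⟨C, hC⟩ := hD.exists_bound_of_continuousOn hcont.continuousOn
    refine ⟨C, fun x => ?_⟩
    simpa using! hC _ (mem_image_of_mem _ x.2)
  obtain ⟨C, hC⟩ := banach_steinhaus hb
  exact ⟨C, fun x hx => ((NormedSpace.inclusionInDoubleDualLi ℝ).norm_map x).symm.trans_le
    (hC ⟨x, hx⟩)⟩

end WeakTopology

section Geometry

variable {X : Type*} [NormedAddCommGroup X] [NormedSpace ℝ X]

/-- Scaled form of uniform convexity in every direction: the midpoint of two points `a ≠ b`
is uniformly closer than `R` to every point that is `R`-close to both. -/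
lemma UCED.exists_norm_sub_midpoint_le (hX : UCED X) {a b : X} (hab : a ≠ b) {M : ℝ}
    (hM : 0 < M) : ∃ δ > 0, ∀ R, 0 < R → R ≤ M → ∀ x, ‖x - a‖ ≤ R → ‖x - b‖ ≤ R →
      ‖x - midpoint ℝ a b‖ ≤ R * (1 - δ) := by
  have hd : 0 < ‖b - a‖ := norm_pos_iff.2 (sub_ne_zero.2 hab.symm)
  by_cases hε : ‖b - a‖ / M ≤ 2
  · obtain ⟨δ, hδ, h⟩ := hX (‖b - a‖ / M) ⟨by positivity, hε⟩ (‖b - a‖⁻¹ • (b - a))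
      (by rw [norm_smul, norm_inv, norm_norm, inv_mul_cancel₀ hd.ne'])
    refine ⟨δ, hδ, fun R hR hRM x hxa hxb => ?_⟩
    have hnorm : ∀ v : X, ‖v‖ ≤ R → ‖R⁻¹ • v‖ ≤ 1 := fun v hv => by
      rw [norm_smul, norm_inv, Real.norm_of_nonneg hR.le, inv_mul_le_iff₀ hR]
      simpa using hv
    have hle : ‖b - a‖ ≤ 2 * R := by
      calc ‖b - a‖ = ‖(x - a) - (x - b)‖ := by congr 1; abel
        _ ≤ ‖x - a‖ + ‖x - b‖ := norm_sub_le _ _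
        _ ≤ 2 * R := by linarith
    have key := h (R⁻¹ • (x - a)) (R⁻¹ • (x - b)) (hnorm _ hxa) (hnorm _ hxb)
      ⟨‖b - a‖ / R, Or.inr ⟨by gcongr, by rwa [div_le_iff₀ hR]⟩, by
        rw [smul_smul, ← smul_sub, div_mul_eq_mul_div, mul_inv_cancel₀ hd.ne', one_div]
        congr 1; abel⟩
    have heq : R⁻¹ • (x - a) + R⁻¹ • (x - b) = (2 * R⁻¹) • (x - midpoint ℝ a b) := by
      rw [midpoint_eq_smul_add, invOf_eq_inv]
      module
    rw [heq, norm_smul, Real.norm_of_nonneg (by positivity), mul_assoc] at key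
    have key' := le_of_mul_le_mul_left key two_pos
    rwa [inv_mul_le_iff₀ hR] at key'
  · refine ⟨1, one_pos, fun R hR hRM x hxa hxb => absurd ?_ hε⟩
    rw [div_le_iff₀ hM]
    calc ‖b - a‖ = ‖(x - a) - (x - b)‖ := by congr 1; abel
      _ ≤ ‖x - a‖ + ‖x - b‖ := norm_sub_le _ _
      _ ≤ 2 * M := by linarith

lemma UCED.strictConvexSpace (hX : UCED X) : StrictConvexSpace ℝ X := by
  refine StrictConvexSpace.of_norm_add_ne_two fun x y hx hy hxy h => ?_
  have hne : -x ≠ -y := fun h => hxy (neg_injective h)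
  obtain ⟨δ, hδ, hm⟩ := hX.exists_norm_sub_midpoint_le hne one_pos
  have key := hm 1 one_pos le_rfl 0 (by simp [hx]) (by simp [hy])
  have heq : (0 : X) - midpoint ℝ (-x) (-y) = (2⁻¹ : ℝ) • (x + y) := by
    rw [midpoint_eq_smul_add, invOf_eq_inv]
    module
  rw [heq, norm_smul, h] at key
  norm_num at key
  linarith

/-- In a strictly convex space a point that is at least as close to `p` and `q` as a point `m` of
the segment `[p, q]` coincides with `m`. -/
lemma eq_of_mem_segment_of_norm_sub_le [StrictConvexSpace ℝ X] {p q m w : X}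
    (hm : m ∈ segment ℝ p q) (hp : ‖w - p‖ ≤ ‖m - p‖) (hq : ‖w - q‖ ≤ ‖m - q‖) : w = m := by
  by_contra hne
  have h2 : (0 : ℝ) < 1 / 2 := by norm_num
  have hcp := combo_mem_ball_of_ne (z := p) (mem_closedBall_iff_norm.2 hp)
    (mem_closedBall_iff_norm.2 le_rfl) hne h2 h2 (by norm_num)
  have hcq := combo_mem_ball_of_ne (z := q) (mem_closedBall_iff_norm.2 hq)
    (mem_closedBall_iff_norm.2 le_rfl) hne h2 h2 (by norm_num)
  rw [Metric.mem_ball, ← dist_eq_norm] at hcp hcq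
  have h1 := dist_add_dist_of_mem_segment hm
  have h3 := dist_triangle_left p q (((1 : ℝ) / 2) • w + ((1 : ℝ) / 2) • m)
  rw [dist_comm p m] at h1
  linarith

/-- In a strictly convex space nearest points in convex sets are unique. -/
lemma eq_of_norm_sub_le_infDist [StrictConvexSpace ℝ X] {A : Set X} (hA : Convex ℝ A) {x u v : X}
    (hu : u ∈ A) (hv : v ∈ A) (hxu : ‖x - u‖ ≤ Metric.infDist x A)
    (hxv : ‖x - v‖ ≤ Metric.infDist x A) : u = v := by
  by_contra hne
  have h2 : (0 : ℝ) < 1 / 2 := by norm_num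
  rw [norm_sub_rev] at hxu hxv
  have hc := combo_mem_ball_of_ne (z := x) (mem_closedBall_iff_norm.2 hxu)
    (mem_closedBall_iff_norm.2 hxv) hne h2 h2 (by norm_num)
  have hmem := hA hu hv h2.le h2.le (by norm_num)
  rw [Metric.mem_ball, dist_comm] at hc
  exact absurd (Metric.infDist_le_dist_of_mem hmem) (not_le.2 hc)

/-- A bounded sequence in a UCED space has, along any ultrafilter, a unique asymptotic center with
respect to a weakly compact convex set. -/
lemma UCED.exists_asymptotic_center (hX : UCED X) {D : Set X} (hne : D.Nonempty)
    (hconv : Convex ℝ D) (hD : IsCompact (toWeakSpace ℝ X '' D)) (U : Ultrafilter ℕ)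
    {x : ℕ → X} {C : ℝ} (hx : ∀ n, ‖x n‖ ≤ C) :
    ∃ z ∈ D, ∀ w ∈ D, (∀ ε > 0, ∀ᶠ n in U, ‖x n - w‖ ≤ ‖x n - z‖ + ε) → w = z := by
  have hlim : ∀ v, ∃ c, Tendsto (fun n => ‖x n - v‖) U (𝓝 c) := fun v => by
    have hmem : ∀ n, ‖x n - v‖ ∈ Icc 0 (C + ‖v‖) := fun n =>
      ⟨norm_nonneg _, (norm_sub_le _ _).trans (by linarith [hx n])⟩
    obtain ⟨c, -, hc⟩ := isCompact_Icc.ultrafilter_le_nhds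
      (U.map fun n => ‖x n - v‖) (by
        rw [le_principal_iff]
        exact mem_map.2 (univ_mem' hmem))
    exact ⟨c, hc⟩
  choose φ hφ using hlim
  have hlip : LipschitzWith 1 φ := LipschitzWith.of_le_add fun v w =>
    le_of_tendsto_of_tendsto' (hφ v) ((hφ w).add_const _) fun n => by
      rw [dist_comm, dist_eq_norm]
      exact norm_sub_le_norm_sub_add_norm_sub _ _ _
  have hcvx : ConvexOn ℝ univ φ := by
    refine ⟨convex_univ, fun v _ w _ a b ha hb hab => ?_⟩
    refine le_of_tendsto_of_tendsto' (hφ _) (((hφ v).const_mul a).add ((hφ w).const_mul b))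
      fun n => ?_
    calc ‖x n - (a • v + b • w)‖ = ‖a • (x n - v) + b • (x n - w)‖ := by
          congr 1
          rw [smul_sub, smul_sub, sub_add_sub_comm, ← add_smul, hab, one_smul]
      _ ≤ a * ‖x n - v‖ + b * ‖x n - w‖ := by
          refine (norm_add_le _ _).trans_eq ?_
          rw [norm_smul, norm_smul, Real.norm_of_nonneg ha, Real.norm_of_nonneg hb]
  obtain ⟨z, hz, hmin⟩ := hcvx.exists_isMinOn_of_isCompact_weakSpace hlip.continuous hne hD
  refine ⟨z, hz, fun w hw hwz => ?_⟩
  by_contra hne'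
  have hr0 : 0 ≤ φ z := ge_of_tendsto' (hφ z) fun n => norm_nonneg _
  have hle : φ w ≤ φ z := le_of_forall_pos_le_add fun ε hε =>
    le_of_tendsto_of_tendsto (hφ w) ((hφ z).add_const ε) (hwz ε hε)
  obtain ⟨δ, hδ, hm⟩ := hX.exists_norm_sub_midpoint_le hne' (M := φ z + 1) (by linarith)
  have hbound : ∀ R, φ z < R → R ≤ φ z + 1 → φ z ≤ R * (1 - δ) := fun R hR hR1 => by
    refine (hmin (hconv.midpoint_mem hw hz)).trans (le_of_tendsto (hφ _) ?_)
    filter_upwards [(hφ w).eventually_le_const (hle.trans_lt hR),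
      (hφ z).eventually_le_const hR] with n h1 h2
    exact hm R (hr0.trans_lt hR) hR1 _ h1 h2
  have hpos : 0 < φ z := by
    have hd : dist w z ≤ φ w + φ z := ge_of_tendsto' ((hφ w).add (hφ z)) fun n => by
      rw [← dist_eq_norm, ← dist_eq_norm]
      exact dist_triangle_left _ _ _
    linarith [dist_pos.2 hne']
  have hlim : Tendsto (fun R => R * (1 - δ)) (𝓝[>] φ z) (𝓝 (φ z * (1 - δ))) :=
    ((continuous_id.mul continuous_const).tendsto _).mono_left nhdsWithin_le_nhds
  have hfin : φ z ≤ φ z * (1 - δ) := by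
    refine ge_of_tendsto hlim ?_
    filter_upwards [Ioc_mem_nhdsGT (show φ z < φ z + 1 by linarith)] with R hR
    exact hbound R hR.1 hR.2
  nlinarith

end Geometry

section Iteration

variable {X : Type*} [NormedAddCommGroup X] [NormedSpace ℝ X]

/-- The Goebel–Kirk inequality for averaged iterations. -/
lemma goebel_kirk_inequality {r : ℝ} (hr : r ∈ Ioo (0 : ℝ) 1) {x y : ℕ → X}
    (hx : ∀ n, x (n + 1) = (1 - r) • x n + r • y n)
    (hy : ∀ n, ‖y (n + 1) - y n‖ ≤ ‖x (n + 1) - x n‖)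
    (hanti : Antitone fun n => ‖x n - y n‖) (n i : ℕ) :
    (1 + n * r) * ‖x i - y i‖ ≤
      ‖y (i + n) - x i‖ + ((1 - r)⁻¹) ^ n * (‖x i - y i‖ - ‖x (i + n) - y (i + n)‖) := by
  have hr0 := hr.1
  have hr1 : 0 < 1 - r := by linarith [hr.2]
  have hstep : ∀ k, ‖x (k + 1) - x k‖ = r * ‖x k - y k‖ := fun k => by
    rw [hx, norm_sub_rev (x k), ← Real.norm_of_nonneg hr0.le, ← norm_smul,
      Real.norm_of_nonneg hr0.le]
    congr 1
    module
  have hdrift : ∀ i m, ‖y (i + m) - y i‖ ≤ m * (r * ‖x i - y i‖) := fun i m => by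
    induction m with
    | zero => simp
    | succ m ih =>
      have h1 : ‖y (i + m + 1) - y (i + m)‖ ≤ r * ‖x i - y i‖ :=
        (hy _).trans ((hstep _).trans_le (by gcongr; exact hanti (Nat.le_add_right i m)))
      have h2 := norm_sub_le_norm_sub_add_norm_sub (y (i + m + 1)) (y (i + m)) (y i)
      rw [← add_assoc]
      push_cast
      linarith
  induction n generalizing i with
  | zero => simp [norm_sub_rev]
  | succ n ih =>
    have ih' := ih (i + 1)
    rw [show i + 1 + n = i + (n + 1) by ring] at ih'
    set q : ℝ := ((1 - r)⁻¹) ^ n with hq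
    have hbern : 1 + n * r ≤ q := by
      have h1 : 1 + r ≤ (1 - r)⁻¹ := by
        rw [le_inv_comm₀ (by linarith) hr1, inv_eq_one_div, le_div_iff₀ (by linarith)]
        nlinarith
      calc 1 + n * r ≤ (1 + r) ^ n := one_add_mul_le_pow (by linarith) n
        _ ≤ q := pow_le_pow_left₀ (by linarith) h1 n
    have hsplit : ‖y (i + (n + 1)) - x (i + 1)‖ ≤
        (1 - r) * ‖y (i + (n + 1)) - x i‖ + r * ((n + 1) * (r * ‖x i - y i‖)) := by
      have heq : y (i + (n + 1)) - x (i + 1) =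
          (1 - r) • (y (i + (n + 1)) - x i) + r • (y (i + (n + 1)) - y i) := by
        rw [hx]
        module
      have hd := hdrift i (n + 1)
      push_cast at hd
      rw [heq]
      refine (norm_add_le _ _).trans ?_
      rw [norm_smul, norm_smul, Real.norm_of_nonneg hr0.le, Real.norm_of_nonneg hr1.le]
      gcongr
    have hdec : ‖x (i + 1) - y (i + 1)‖ ≤ ‖x i - y i‖ := hanti (Nat.le_succ i)
    have hpow : (1 - r) * ((1 - r)⁻¹) ^ (n + 1) = q := by
      rw [pow_succ, hq]
      field_simp
    refine le_of_mul_le_mul_left ?_ hr1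
    rw [mul_add, ← mul_assoc (1 - r) (((1 - r)⁻¹) ^ (n + 1)), hpow]
    push_cast
    nlinarith [mul_nonneg (sub_nonneg.2 hbern) (sub_nonneg.2 hdec)]

/-- Bounded averaged iterations are asymptotically regular. -/
lemma tendsto_norm_sub_of_averaged_iteration {r : ℝ} (hr : r ∈ Ioo (0 : ℝ) 1) {x y : ℕ → X}
    (hx : ∀ n, x (n + 1) = (1 - r) • x n + r • y n)
    (hy : ∀ n, ‖y (n + 1) - y n‖ ≤ ‖x (n + 1) - x n‖)
    {C : ℝ} (hxC : ∀ n, ‖x n‖ ≤ C) (hyC : ∀ n, ‖y n‖ ≤ C) :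
    Tendsto (fun n => ‖x n - y n‖) atTop (𝓝 0) := by
  have hr0 := hr.1
  have hr1 : 0 < 1 - r := by linarith [hr.2]
  have hanti : Antitone fun n => ‖x n - y n‖ := antitone_nat_of_succ_le fun n => by
    have h1 : x (n + 1) - y n = (1 - r) • (x n - y n) := by rw [hx]; module
    have h2 : x (n + 1) - x n = r • (y n - x n) := by rw [hx]; module
    have h3 := hy n
    rw [h2, norm_smul, Real.norm_of_nonneg hr0.le, norm_sub_rev (y (n + 1)),
      norm_sub_rev (y n) (x n)] at h3
    calc ‖x (n + 1) - y (n + 1)‖ ≤ ‖x (n + 1) - y n‖ + ‖y n - y (n + 1)‖ :=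
          norm_sub_le_norm_sub_add_norm_sub _ _ _
      _ ≤ (1 - r) * ‖x n - y n‖ + r * ‖x n - y n‖ := by
          rw [h1, norm_smul, Real.norm_of_nonneg hr1.le]
          gcongr
      _ = ‖x n - y n‖ := by ring
  obtain ⟨a, ha⟩ : ∃ a, Tendsto (fun n => ‖x n - y n‖) atTop (𝓝 a) :=
    ⟨_, tendsto_atTop_ciInf hanti ⟨0, by rintro _ ⟨n, rfl⟩; exact norm_nonneg _⟩⟩
  have ha0 : 0 ≤ a := ge_of_tendsto' ha fun n => norm_nonneg _
  have hbound : ∀ n : ℕ, (1 + n * r) * a ≤ 2 * C := fun n => by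
    have h1 : Tendsto (fun i => (1 + n * r) * ‖x i - y i‖ - ((1 - r)⁻¹) ^ n *
        (‖x i - y i‖ - ‖x (i + n) - y (i + n)‖)) atTop
        (𝓝 ((1 + n * r) * a - ((1 - r)⁻¹) ^ n * (a - a))) :=
      (ha.const_mul _).sub ((ha.sub (ha.comp (tendsto_add_atTop_nat n))).const_mul _)
    rw [sub_self, mul_zero, sub_zero] at h1
    refine le_of_tendsto' h1 fun i => ?_
    have h2 := goebel_kirk_inequality hr hx hy hanti n i
    have h3 := norm_sub_le (y (i + n)) (x i)
    linarith [hxC i, hyC (i + n)]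
  rcases ha0.eq_or_lt with h | h
  · rwa [h]
  · obtain ⟨n, hn⟩ := exists_nat_gt (2 * C / (r * a))
    rw [div_lt_iff₀ (by positivity)] at hn
    nlinarith [hbound n]

/-- A multivalued mapping with nonexpansive selections along averaged steps admits approximate
fixed point sequences. -/
lemma exists_approximate_fixed_points {r : ℝ} (hr : r ∈ Ioo (0 : ℝ) 1) {K : Set X}
    (hne : K.Nonempty) (hK : Convex ℝ K) {C : ℝ} (hC : ∀ x ∈ K, ‖x‖ ≤ C) (S : X → Set X)
    (hS : ∀ x ∈ K, (S x ∩ K).Nonempty)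
    (hstep : ∀ x ∈ K, ∀ x' ∈ K, ∀ y ∈ S x ∩ K, r * ‖x - y‖ = ‖x - x'‖ →
      ∃ y' ∈ S x' ∩ K, ‖y' - y‖ ≤ ‖x' - x‖) :
    ∃ x y : ℕ → X, (∀ n, x n ∈ K) ∧ (∀ n, y n ∈ S (x n)) ∧
      Tendsto (fun n => ‖x n - y n‖) atTop (𝓝 0) := by
  let P := {p : X × X // p.1 ∈ K ∧ p.2 ∈ S p.1 ∩ K}
  have hnext : ∀ p : P, ∃ p' : P, p'.1.1 = (1 - r) • p.1.1 + r • p.1.2 ∧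
      ‖p'.1.2 - p.1.2‖ ≤ ‖p'.1.1 - p.1.1‖ := by
    rintro ⟨⟨x, y⟩, hx, hy⟩
    have hx' : (1 - r) • x + r • y ∈ K :=
      hK hx hy.2 (by linarith [hr.2]) hr.1.le (by ring)
    obtain ⟨y', hy', hle⟩ := hstep x hx _ hx' y hy (by
      rw [← Real.norm_of_nonneg hr.1.le, ← norm_smul, Real.norm_of_nonneg hr.1.le]
      congr 1
      module)
    exact ⟨⟨(_, y'), hx', hy'⟩, rfl, hle⟩
  choose next hnext₁ hnext₂ using hnext
  obtain ⟨x₀, hx₀⟩ := hne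
  obtain ⟨y₀, hy₀⟩ := hS x₀ hx₀
  let s : ℕ → P := fun n => next^[n] ⟨(x₀, y₀), hx₀, hy₀⟩
  have hs : ∀ n, s (n + 1) = next (s n) := fun n => Function.iterate_succ_apply' _ _ _
  refine ⟨fun n => (s n).1.1, fun n => (s n).1.2, fun n => (s n).2.1, fun n => (s n).2.2.1,
    tendsto_norm_sub_of_averaged_iteration hr (fun n => ?_) (fun n => ?_)
      (fun n => hC _ (s n).2.1) (fun n => hC _ (s n).2.2.2)⟩
  · rw [hs]; exact hnext₁ _
  · rw [hs]; exact hnext₂ _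

end Iteration

section FixedPoints

variable {X : Type*} [NormedAddCommGroup X] {D : Set X}

/-- A mapping with property `(C_l)` is quasi-nonexpansive. -/
lemma norm_sub_le_of_fixed {t : X → X} {l : ℝ}
    (htC : ∀ x ∈ D, ∀ y ∈ D, l * ‖x - t x‖ ≤ ‖x - y‖ → ‖t x - t y‖ ≤ ‖x - y‖)
    {p y : X} (hp : p ∈ D) (htp : t p = p) (hy : y ∈ D) : ‖p - t y‖ ≤ ‖p - y‖ := by
  simpa [htp] using htC p hp y hy (by simp [htp])

/-- A unique asymptotic center of an approximate fixed point sequence of a mapping with compact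
values and property `(E)` is a fixed point. -/
lemma mem_of_asymptotic_center {T : X → Set X} {U : Ultrafilter ℕ} (hU : (U : Filter ℕ) ≤ atTop)
    {x y : ℕ → X} (hxD : ∀ n, x n ∈ D) (hy : ∀ n, y n ∈ T (x n))
    (hlim : Tendsto (fun n => ‖x n - y n‖) atTop (𝓝 0)) {z : X} (hz : z ∈ D)
    (huniq : ∀ w ∈ D, (∀ ε > 0, ∀ᶠ n in U, ‖x n - w‖ ≤ ‖x n - z‖ + ε) → w = z)
    (hTne : (T z).Nonempty) (hTcp : IsCompact (T z)) (hTsub : T z ⊆ D) {μ : ℝ} (hμ : 0 ≤ μ)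
    (hTE : ∀ x ∈ D, ∀ y ∈ D,
      Metric.infDist x (T y) ≤ μ * Metric.infDist x (T x) + ‖x - y‖) : z ∈ T z := by
  choose u huT hu using fun n => hTcp.exists_infDist_eq_dist hTne (x n)
  obtain ⟨v, hv, huv⟩ := hTcp.ultrafilter_le_nhds (U.map u) (by
    rw [le_principal_iff]
    exact mem_map.2 (univ_mem' huT))
  have huv' : Tendsto u U (𝓝 v) := huv
  have h0 := ((hlim.const_mul μ).mono_left hU).add (tendsto_iff_norm_sub_tendsto_zero.1 huv')
  rw [mul_zero, add_zero] at h0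
  have hvz : v = z := huniq v (hTsub hv) fun ε hε => by
    filter_upwards [h0.eventually_le_const hε] with n hn
    have h1 := hTE _ (hxD n) _ hz
    have h2 : μ * Metric.infDist (x n) (T (x n)) ≤ μ * ‖x n - y n‖ := by
      rw [← dist_eq_norm]
      exact mul_le_mul_of_nonneg_left (Metric.infDist_le_dist_of_mem (hy n)) hμ
    rw [hu n, dist_eq_norm] at h1
    linarith [norm_sub_le_norm_sub_add_norm_sub (x n) (u n) v]
  exact hvz ▸ hv

variable [NormedSpace ℝ X]

lemma exists_fixed_point_UCED [CompleteSpace X] (hX : UCED X) (hne : D.Nonempty)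
    (hconv : Convex ℝ D) (hwcp : IsCompact (toWeakSpace ℝ X '' D)) {t : X → X}
    (ht : MapsTo t D D) {l : ℝ} (hl : l ∈ Ioo (0 : ℝ) 1)
    (htC : ∀ x ∈ D, ∀ y ∈ D, l * ‖x - t x‖ ≤ ‖x - y‖ → ‖t x - t y‖ ≤ ‖x - y‖)
    {μ : ℝ} (htE : ∀ x ∈ D, ∀ y ∈ D, ‖x - t y‖ ≤ μ * ‖x - t x‖ + ‖x - y‖) :
    ∃ z ∈ D, t z = z := by
  obtain ⟨C, hC⟩ := exists_norm_le_of_isCompact_weakSpace hwcp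
  obtain ⟨x, y, hxD, hy, hlim⟩ := exists_approximate_fixed_points hl hne hconv hC
    (fun x => {t x}) (fun x hx => ⟨t x, rfl, ht hx⟩) (by
      rintro x hx x' hx' y ⟨rfl, -⟩ h
      refine ⟨t x', ⟨rfl, ht hx'⟩, ?_⟩
      rw [norm_sub_rev, norm_sub_rev x']
      exact htC x hx x' hx' h.le)
  obtain rfl : y = fun n => t (x n) := funext hy
  obtain ⟨z, hz, huniq⟩ := hX.exists_asymptotic_center hne hconv hwcp (hyperfilter ℕ)
    (fun n => hC _ (hxD n))
  refine ⟨z, hz, huniq _ (ht hz) fun ε hε => ?_⟩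
  have h0 := (hlim.const_mul μ).mono_left Nat.hyperfilter_le_atTop
  rw [mul_zero] at h0
  filter_upwards [h0.eventually_le_const hε] with n hn
  linarith [htE _ (hxD n) _ hz]

/-- In a strictly convex space the nearest point projection onto an invariant compact convex set
sends fixed points to fixed points. -/
lemma exists_fixed_nearest_point [StrictConvexSpace ℝ X] {t : X → X} {A : Set X}
    (hne : A.Nonempty) (hA : IsCompact A) (hconv : Convex ℝ A) (htA : MapsTo t A A) {p : X}
    (hp : ∀ y ∈ A, ‖p - t y‖ ≤ ‖p - y‖) :
    ∃ u ∈ A, t u = u ∧ ‖p - u‖ = Metric.infDist p A := by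
  obtain ⟨u, hu, hdist⟩ := hA.exists_infDist_eq_dist hne p
  rw [dist_eq_norm] at hdist
  exact ⟨u, hu, eq_of_norm_sub_le_infDist hconv (htA hu) hu ((hp u hu).trans hdist.ge) hdist.ge,
    hdist.symm⟩

end FixedPoints

/-- Theorem 3.7: Let `D` be a nonempty weakly compact convex subset of a
UCED Banach space, `t : D → D` a single-valued mapping and `T : D → KC(D)` a
multivalued mapping, both satisfying conditions (E) and `(C_λ)` for some `λ ∈ (0,1)`,
which commute. Then there exists `z ∈ D` with `z = t(z) ∈ T(z)`. -/
theorem common_fixed_point_UCED {X : Type*} [NormedAddCommGroup X]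
    [NormedSpace ℝ X] [CompleteSpace X] (hX : UCED X)
    (D : Set X) (hne : D.Nonempty) (hconv : Convex ℝ D)
    (hwcp : IsCompact (toWeakSpace ℝ X '' D))
    (t : X → X) (ht : Set.MapsTo t D D)
    (T : X → Set X)
    (hTne : ∀ x ∈ D, (T x).Nonempty) (hTcp : ∀ x ∈ D, IsCompact (T x))
    (hTconv : ∀ x ∈ D, Convex ℝ (T x)) (hTsub : ∀ x ∈ D, T x ⊆ D)
    (l : ℝ) (hl : l ∈ Set.Ioo (0:ℝ) 1)
    (htC : ∀ x ∈ D, ∀ y ∈ D, l * ‖x - t x‖ ≤ ‖x - y‖ → ‖t x - t y‖ ≤ ‖x - y‖)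
    (htE : ∃ μ : ℝ, 1 ≤ μ ∧ ∀ x ∈ D, ∀ y ∈ D, ‖x - t y‖ ≤ μ * ‖x - t x‖ + ‖x - y‖)
    (hTC : ∀ x ∈ D, ∀ y ∈ D, l * Metric.infDist x (T x) ≤ ‖x - y‖ →
      Metric.hausdorffDist (T x) (T y) ≤ ‖x - y‖)
    (hTE : ∃ μ : ℝ, 1 ≤ μ ∧ ∀ x ∈ D, ∀ y ∈ D,
      Metric.infDist x (T y) ≤ μ * Metric.infDist x (T x) + ‖x - y‖)
    (hcomm : ∀ x ∈ D, ∀ y ∈ D, x ∈ T y → t y ∈ D → t x ∈ T (t y)) :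
    ∃ z ∈ D, t z = z ∧ z ∈ T z := by
  have := hX.strictConvexSpace
  obtain ⟨μ, hμ, htE⟩ := htE
  obtain ⟨ν, hν, hTE⟩ := hTE
  obtain ⟨C, hC⟩ := exists_norm_le_of_isCompact_weakSpace hwcp
  let K : Set X := {x ∈ D | t x = x}
  have hKne : K.Nonempty := exists_fixed_point_UCED hX hne hconv hwcp ht hl htC htE
  have hKconv : Convex ℝ K := by
    refine convex_iff_segment_subset.2 fun p hp q hq m hm => ?_
    have hmD : m ∈ D := hconv.segment_subset hp.1 hq.1 hm
    refine ⟨hmD, eq_of_mem_segment_of_norm_sub_le hm ?_ ?_⟩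
    · rw [norm_sub_rev, norm_sub_rev m]
      exact norm_sub_le_of_fixed htC hp.1 hp.2 hmD
    · rw [norm_sub_rev, norm_sub_rev m]
      exact norm_sub_le_of_fixed htC hq.1 hq.2 hmD
  have hproj : ∀ x ∈ K, ∀ p ∈ K, ∃ u ∈ T x ∩ K, ‖p - u‖ = Metric.infDist p (T x) := by
    intro x hx p hp
    obtain ⟨u, hu, htu, hdist⟩ := exists_fixed_nearest_point (t := t) (p := p)
      (hTne x hx.1) (hTcp x hx.1) (hTconv x hx.1)
      (fun u hu => by
        simpa only [hx.2] using hcomm u (hTsub x hx.1 hu) x hx.1 hu (ht hx.1))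
      (fun y hy => norm_sub_le_of_fixed htC hp.1 hp.2 (hTsub x hx.1 hy))
    exact ⟨u, ⟨hu, hTsub x hx.1 hu, htu⟩, hdist⟩
  obtain ⟨x, y, hxK, hy, hlim⟩ := exists_approximate_fixed_points hl hKne hKconv
    (fun x hx => hC x hx.1) T (fun x hx => (hproj x hx x hx).imp fun _ h => h.1) (by
      intro x hx x' hx' y hy h
      obtain ⟨y', hy', hdist⟩ := hproj x' hx' y hy.2
      refine ⟨y', hy', ?_⟩
      rw [norm_sub_rev, hdist, norm_sub_rev x']
      refine (Metric.infDist_le_hausdorffDist_of_mem hy.1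
        (Metric.hausdorffEDist_ne_top_of_nonempty_of_bounded (hTne x hx.1) (hTne x' hx'.1)
          (hTcp x hx.1).isBounded (hTcp x' hx'.1).isBounded)).trans
        (hTC x hx.1 x' hx'.1 (le_trans ?_ h.le))
      rw [← dist_eq_norm]
      exact mul_le_mul_of_nonneg_left (Metric.infDist_le_dist_of_mem hy.1) hl.1.le)
  obtain ⟨z, hz, huniq⟩ := hX.exists_asymptotic_center hne hconv hwcp (hyperfilter ℕ)
    (fun n => hC _ (hxK n).1)
  refine ⟨z, hz, huniq _ (ht hz) fun ε hε => Eventually.of_forall fun n => ?_, ?_⟩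
  · linarith [norm_sub_le_of_fixed htC (hxK n).1 (hxK n).2 hz]
  · exact mem_of_asymptotic_center Nat.hyperfilter_le_atTop (fun n => (hxK n).1) hy hlim hz huniq
      (hTne z hz) (hTcp z hz) (hTsub z hz) (zero_le_one.trans hν) hTE
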